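/- The set of discounted visit-count vectors of interior policies is convex: for any finite environment (S, A, T, d0, γ) with γ ∈ [0,1), the image {F^π ∈ ℝ^{S×A} : π ∈ Π^+} of the visit-count map on the interior of the policy space is a convex subset of ℝ^{S×A} (it is the relative interior of the polyhedron cut out by nonnegativity and the Bellman flow constraints Σ_a f(s,a) = d0(s) + γ Σ_{s',a'} T(s|s',a') f(s',a') for all s). -/

import Mathlib

open Matrix

/-- `p` is a probability distribution on the finite set `S`. -/
def IsDist {S : Type*} [Fintype S] (p : S → ℝ) : Prop :=
  (∀ s, 0 ≤ p s) ∧ ∑ s, p s = 1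

/-- `π` is a stationary policy: each `π s` is a distribution over actions. -/
def IsPolicy {S A : Type*} [Fintype A] (π : S → A → ℝ) : Prop :=
  ∀ s, (∀ a, 0 ≤ π s a) ∧ ∑ a, π s a = 1

/-- `T` is a transition model: each `T s a` is a distribution over next states. -/
def IsTransModel {S A : Type*} [Fintype S] (T : S → A → S → ℝ) : Prop :=
  ∀ s a, (∀ s', 0 ≤ T s a s') ∧ ∑ s', T s a s' = 1

/-- The policy-induced transition matrix `P^π(s,s') = Σ_a π(a|s) T(s'|s,a)`. -/
noncomputable def Pmat {S A : Type*} [Fintype A] (T : S → A → S → ℝ)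
    (π : S → A → ℝ) : Matrix S S ℝ :=
  Matrix.of fun s s' => ∑ a, π s a * T s a s'

/-- The policy-induced expected reward vector `r^π(s) = Σ_a π(a|s) R(s,a)`. -/
noncomputable def rvec {S A : Type*} [Fintype A] (R : S → A → ℝ)
    (π : S → A → ℝ) : S → ℝ :=
  fun s => ∑ a, π s a * R s a

/-- The policy value `J(π) = Σ_s d0(s) V^π(s)` with `V^π = (I - γ P^π)⁻¹ r^π`. -/
noncomputable def Jval {S A : Type*} [Fintype S] [Fintype A] [DecidableEq S]
    (T : S → A → S → ℝ) (R : S → A → ℝ) (d0 : S → ℝ) (γ : ℝ)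
    (π : S → A → ℝ) : ℝ :=
  ∑ s, d0 s * (((1 : Matrix S S ℝ) - γ • Pmat T π)⁻¹ *ᵥ rvec R π) s

/-- Discounted visit counts `F^π(s,a) = μ^π(s) π(a|s)` with
`μ^π = (I - γ (P^π)ᵀ)⁻¹ d0`. -/
noncomputable def visitCount {S A : Type*} [Fintype S] [Fintype A] [DecidableEq S]
    (T : S → A → S → ℝ) (d0 : S → ℝ) (γ : ℝ) (π : S → A → ℝ) :
    S → A → ℝ :=
  fun s a => ((((1 : Matrix S S ℝ) - γ • (Pmat T π)ᵀ)⁻¹) *ᵥ d0) s * π s a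

/-- The policy value written as the inner product `J(π) = ⟨R, F^π⟩`. -/
noncomputable def JvisF {S A : Type*} [Fintype S] [Fintype A] [DecidableEq S]
    (T : S → A → S → ℝ) (R : S → A → ℝ) (d0 : S → ℝ) (γ : ℝ)
    (π : S → A → ℝ) : ℝ :=
  ∑ s, ∑ a, R s a * visitCount T d0 γ π s a

/-- The interior `Π⁺` of the policy space: policies with all entries positive. -/
def PiPlus {S A : Type*} [Fintype A] : Set (S → A → ℝ) :=
  {π | IsPolicy π ∧ ∀ s a, 0 < π s a}

/-- `I - γ Qᵀ` is inverse-positive for row-stochastic `Q` and `0 ≤ γ < 1`. -/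
theorem nonneg_of_one_sub_smul_transpose_mulVec_nonneg {S : Type*} [Fintype S] [DecidableEq S]
    {Q : Matrix S S ℝ} (hQ : ∀ s s', 0 ≤ Q s s') (hQ1 : ∀ s, ∑ s', Q s s' = 1)
    {γ : ℝ} (hγ0 : 0 ≤ γ) (hγ1 : γ < 1) {x : S → ℝ}
    (hx : ∀ s, 0 ≤ (((1 : Matrix S S ℝ) - γ • Qᵀ) *ᵥ x) s) (s : S) : 0 ≤ x s := by
  have hle : ∀ s, max (-x s) 0 ≤ γ * ∑ s', Q s' s * max (-x s') 0 := by
    intro s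
    have hs := hx s
    rw [sub_mulVec, one_mulVec, smul_mulVec] at hs
    simp only [Pi.sub_apply, Pi.smul_apply, smul_eq_mul, mulVec, dotProduct,
      transpose_apply] at hs
    refine max_le ?_ (mul_nonneg hγ0 (Finset.sum_nonneg fun s' _ =>
      mul_nonneg (hQ s' s) (le_max_right _ _)))
    calc -x s ≤ γ * ∑ s', Q s' s * -x s' := by
          simp only [mul_neg, Finset.sum_neg_distrib]; linarith
      _ ≤ _ := by
          gcongr with s' _
          · exact hQ s' s
          · exact le_max_left _ _
  have hsum : ∑ s, max (-x s) 0 ≤ γ * ∑ s, max (-x s) 0 := by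
    calc ∑ s, max (-x s) 0 ≤ ∑ s, γ * ∑ s', Q s' s * max (-x s') 0 :=
          Finset.sum_le_sum fun s _ => hle s
      _ = γ * ∑ s, max (-x s) 0 := by
          rw [← Finset.mul_sum, Finset.sum_comm]
          simp only [← Finset.sum_mul, hQ1, one_mul]
  have hs : max (-x s) 0 ≤ ∑ s, max (-x s) 0 :=
    Finset.single_le_sum (f := fun s => max (-x s) 0)
      (fun s _ => le_max_right _ _) (Finset.mem_univ s)
  have := le_max_left (-x s) 0
  nlinarith

theorem isUnit_one_sub_smul_transpose {S : Type*} [Fintype S] [DecidableEq S]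
    {Q : Matrix S S ℝ} (hQ : ∀ s s', 0 ≤ Q s s') (hQ1 : ∀ s, ∑ s', Q s s' = 1)
    {γ : ℝ} (hγ0 : 0 ≤ γ) (hγ1 : γ < 1) : IsUnit ((1 : Matrix S S ℝ) - γ • Qᵀ) := by
  refine mulVec_injective_iff_isUnit.mp fun x y hxy => funext fun s => le_antisymm ?_ ?_
  · have h := nonneg_of_one_sub_smul_transpose_mulVec_nonneg hQ hQ1 hγ0 hγ1 (x := y - x)
      (fun s => by rw [mulVec_sub, hxy, sub_self]; rfl) s
    simpa using h
  · have h := nonneg_of_one_sub_smul_transpose_mulVec_nonneg hQ hQ1 hγ0 hγ1 (x := x - y)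
      (fun s => by rw [mulVec_sub, hxy, sub_self]; rfl) s
    simpa using h

theorem Pmat_nonneg {S A : Type*} [Fintype S] [Fintype A] {T : S → A → S → ℝ}
    (hT : IsTransModel T) {π : S → A → ℝ} (hπ : IsPolicy π) (s s' : S) : 0 ≤ Pmat T π s s' :=
  Finset.sum_nonneg fun a _ => mul_nonneg ((hπ s).1 a) ((hT s a).1 s')

theorem sum_Pmat {S A : Type*} [Fintype S] [Fintype A] {T : S → A → S → ℝ}
    (hT : IsTransModel T) {π : S → A → ℝ} (hπ : IsPolicy π) (s : S) :
    ∑ s', Pmat T π s s' = 1 := by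
  simp only [Pmat, of_apply]
  rw [Finset.sum_comm]
  simp only [← Finset.mul_sum, (hT s _).2, mul_one, (hπ s).2]

theorem one_sub_smul_Pmat_transpose_mulVec {S A : Type*} [Fintype S] [Fintype A] [DecidableEq S]
    (T : S → A → S → ℝ) (γ : ℝ) (π : S → A → ℝ) (m : S → ℝ) (s : S) :
    (((1 : Matrix S S ℝ) - γ • (Pmat T π)ᵀ) *ᵥ m) s =
      m s - γ * ∑ s', ∑ a, m s' * π s' a * T s' a s := by
  rw [sub_mulVec, one_mulVec, smul_mulVec]
  simp only [Pi.sub_apply, Pi.smul_apply, smul_eq_mul, mulVec, dotProduct, transpose_apply,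
    Pmat, of_apply, Finset.sum_mul]
  congr! 4
  ring

/-- The visit counts of a policy are determined by the Bellman flow constraints. -/
theorem visitCount_eq_of_flow {S A : Type*} [Fintype S] [Fintype A] [DecidableEq S]
    {T : S → A → S → ℝ} (hT : IsTransModel T) {d0 : S → ℝ} {γ : ℝ} (hγ0 : 0 ≤ γ) (hγ1 : γ < 1)
    {π : S → A → ℝ} (hπ : IsPolicy π) {m : S → ℝ}
    (hm : ∀ s, m s - γ * ∑ s', ∑ a, m s' * π s' a * T s' a s = d0 s) :
    visitCount T d0 γ π = fun s a => m s * π s a := by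
  have hdet := (isUnit_iff_isUnit_det _).mp
    (isUnit_one_sub_smul_transpose (Pmat_nonneg hT hπ) (sum_Pmat hT hπ) hγ0 hγ1)
  have h : ((1 : Matrix S S ℝ) - γ • (Pmat T π)ᵀ) *ᵥ m = d0 :=
    funext fun s => (one_sub_smul_Pmat_transpose_mulVec T γ π m s).trans (hm s)
  unfold visitCount
  rw [← h, mulVec_mulVec, nonsing_inv_mul _ hdet, one_mulVec]

theorem exists_flow_of_isPolicy {S A : Type*} [Fintype S] [Fintype A] [DecidableEq S]
    {T : S → A → S → ℝ} (hT : IsTransModel T) {d0 : S → ℝ} (hd0 : ∀ s, 0 ≤ d0 s)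
    {γ : ℝ} (hγ0 : 0 ≤ γ) (hγ1 : γ < 1) {π : S → A → ℝ} (hπ : IsPolicy π) :
    ∃ m : S → ℝ, (∀ s, 0 ≤ m s) ∧
      ∀ s, m s - γ * ∑ s', ∑ a, m s' * π s' a * T s' a s = d0 s := by
  have hdet := (isUnit_iff_isUnit_det _).mp
    (isUnit_one_sub_smul_transpose (Pmat_nonneg hT hπ) (sum_Pmat hT hπ) hγ0 hγ1)
  have h : ((1 : Matrix S S ℝ) - γ • (Pmat T π)ᵀ) *ᵥ
      (((1 : Matrix S S ℝ) - γ • (Pmat T π)ᵀ)⁻¹ *ᵥ d0) = d0 := by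
    rw [mulVec_mulVec, mul_nonsing_inv _ hdet, one_mulVec]
  refine ⟨((1 : Matrix S S ℝ) - γ • (Pmat T π)ᵀ)⁻¹ *ᵥ d0, ?_, fun s => ?_⟩
  · exact nonneg_of_one_sub_smul_transpose_mulVec_nonneg (Pmat_nonneg hT hπ) (sum_Pmat hT hπ)
      hγ0 hγ1 fun s => by rw [h]; exact hd0 s
  · rw [← one_sub_smul_Pmat_transpose_mulVec, h]

/-- Every mixture `u m₁ π₁ + v m₂ π₂` factors as its state marginal times an interior policy. -/
theorem exists_mem_PiPlus_mul_eq {S A : Type*} [Fintype A] {π₁ π₂ : S → A → ℝ}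
    (h₁ : π₁ ∈ PiPlus) (h₂ : π₂ ∈ PiPlus) {m₁ m₂ : S → ℝ}
    (hm₁ : ∀ s, 0 ≤ m₁ s) (hm₂ : ∀ s, 0 ≤ m₂ s) {u v : ℝ} (hu : 0 ≤ u) (hv : 0 ≤ v) :
    ∃ π ∈ (PiPlus : Set (S → A → ℝ)), ∀ s a,
      (u * m₁ s + v * m₂ s) * π s a = u * (m₁ s * π₁ s a) + v * (m₂ s * π₂ s a) := by
  have key : ∀ s, ∃ p : A → ℝ, (∀ a, 0 < p a) ∧ ∑ a, p a = 1 ∧ ∀ a,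
      (u * m₁ s + v * m₂ s) * p a = u * (m₁ s * π₁ s a) + v * (m₂ s * π₂ s a) := by
    intro s
    have hum := mul_nonneg hu (hm₁ s)
    have hvm := mul_nonneg hv (hm₂ s)
    rcases (add_nonneg hum hvm).eq_or_lt with h0 | hpos
    · have hu0 : u * m₁ s = 0 := by linarith
      have hv0 : v * m₂ s = 0 := by linarith
      exact ⟨π₁ s, h₁.2 s, (h₁.1 s).2, fun a => by simp [← mul_assoc, hu0, hv0]⟩
    · refine ⟨fun a => (u * m₁ s * π₁ s a + v * m₂ s * π₂ s a) / (u * m₁ s + v * m₂ s),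
        fun a => div_pos ?_ hpos, ?_, fun a => ?_⟩
      · rcases hum.eq_or_lt with h | h
        · rw [← h, zero_add] at hpos
          rw [← h, zero_mul, zero_add]
          exact mul_pos hpos (h₂.2 s a)
        · exact add_pos_of_pos_of_nonneg (mul_pos h (h₁.2 s a)) (mul_nonneg hvm (h₂.2 s a).le)
      · rw [← Finset.sum_div, Finset.sum_add_distrib, ← Finset.mul_sum, ← Finset.mul_sum,
          (h₁.1 s).2, (h₂.1 s).2, mul_one, mul_one, div_self hpos.ne']
      · rw [mul_div_cancel₀ _ hpos.ne']
        ring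
  choose π hpos hsum hmul using key
  exact ⟨π, ⟨fun s => ⟨fun a => (hpos s a).le, hsum s⟩, hpos⟩, hmul⟩

/-- **Convexity of the visit-count image**: the set of discounted visit-count
vectors of interior policies is a convex subset of `ℝ^{S×A}`. -/
theorem stmt6 {S A : Type*} [Fintype S] [Fintype A] [DecidableEq S] [Nonempty S]
    (hA : 1 < Fintype.card A)
    (T : S → A → S → ℝ) (hT : IsTransModel T)
    (d0 : S → ℝ) (hd0 : IsDist d0)
    (γ : ℝ) (hγ0 : 0 ≤ γ) (hγ1 : γ < 1) :
    Convex ℝ ((fun π => visitCount T d0 γ π) '' PiPlus) := by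
  rintro _ ⟨π₁, h₁, rfl⟩ _ ⟨π₂, h₂, rfl⟩ u v hu hv huv
  obtain ⟨m₁, hm₁, hflow₁⟩ := exists_flow_of_isPolicy hT hd0.1 hγ0 hγ1 h₁.1
  obtain ⟨m₂, hm₂, hflow₂⟩ := exists_flow_of_isPolicy hT hd0.1 hγ0 hγ1 h₂.1
  obtain ⟨π, hπ, hmul⟩ := exists_mem_PiPlus_mul_eq h₁ h₂ hm₁ hm₂ hu hv
  refine ⟨π, hπ, ?_⟩
  have hflow : ∀ s, (u * m₁ s + v * m₂ s) -
      γ * ∑ s', ∑ a, (u * m₁ s' + v * m₂ s') * π s' a * T s' a s = d0 s := by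
    intro s
    simp only [hmul, add_mul, Finset.sum_add_distrib, mul_assoc u, mul_assoc v, ← Finset.mul_sum]
    linear_combination u * hflow₁ s + v * hflow₂ s + d0 s * huv
  simp only [visitCount_eq_of_flow hT hγ0 hγ1 h₁.1 hflow₁,
    visitCount_eq_of_flow hT hγ0 hγ1 h₂.1 hflow₂,
    visitCount_eq_of_flow hT hγ0 hγ1 hπ.1 hflow]
  ext s a
  simpa using hmul s a
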